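/- arXiv:2312.01819 — 2 statements merged into one kernel-verified Lean document; each statement's English description precedes it below -/
import Mathlib

section
/- For every α ∈ (0,∞) with α ≠ 1 and every t ∈ (0, t_α), the map t ↦ h_α(p(·,t)) is differentiable and ∂h_α(p(·,t))/∂t = (α/2) · (∫ p(x,t)^{α-2} p_1(x,t)² dx) / (∫ p(x,t)^α dx); equivalently ∂h_α(p(·,t))/∂t = (α/2) · E_α[p̄₁²]. -/
open MeasureTheory Real Filter
open scoped Classical

/-- The density `p(x,t)` of `X + √t Z` along the heat flow. -/
noncomputable def heatP (f : ℝ → ℝ) (t x : ℝ) : ℝ :=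
  ∫ y : ℝ, f y * ((Real.sqrt (2 * Real.pi * t))⁻¹ * Real.exp (-(x - y) ^ 2 / (2 * t)))

/-- `p_k(x,t) = ∂^k p / ∂x^k`. -/
noncomputable def pk (f : ℝ → ℝ) (k : ℕ) (t x : ℝ) : ℝ :=
  iteratedDeriv k (heatP f t) x

/-- `p̄_i = p_i / p`. -/
noncomputable def pbar (f : ℝ → ℝ) (i : ℕ) (t x : ℝ) : ℝ :=
  pk f i t x / heatP f t x

/-- The Rényi entropy `h_α(p(·,t))`, with the Shannon entropy at `α = 1`. -/
noncomputable def renyiEnt (f : ℝ → ℝ) (α t : ℝ) : ℝ :=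
  if α = 1 then -∫ x : ℝ, heatP f t x * Real.log (heatP f t x)
  else (1 - α)⁻¹ * Real.log (∫ x : ℝ, heatP f t x ^ α)

/-- Finiteness `|h_α(p(·,t))| < ∞` of the Rényi entropy at time `t`. -/
def renyiFinite (f : ℝ → ℝ) (α t : ℝ) : Prop :=
  if α = 1 then Integrable (fun x : ℝ => heatP f t x * Real.log (heatP f t x))
  else Integrable (fun x : ℝ => heatP f t x ^ α) ∧ 0 < ∫ x : ℝ, heatP f t x ^ α

/-- `t < t_α` where `t_α = sup { s > 0 : |h_α(p(·,s))| < ∞ }`. -/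
def ltTalpha (f : ℝ → ℝ) (α t : ℝ) : Prop :=
  ∃ s : ℝ, t < s ∧ 0 < s ∧ renyiFinite f α s

/-- The tilted expectation `E_α[g] = (∫ g p^α) / (∫ p^α)`. -/
noncomputable def Ea (f : ℝ → ℝ) (α t : ℝ) (g : ℝ → ℝ) : ℝ :=
  (∫ x : ℝ, g x * heatP f t x ^ α) / (∫ x : ℝ, heatP f t x ^ α)

noncomputable def HK (r u : ℝ) : ℝ :=
  (Real.sqrt (2 * Real.pi * r))⁻¹ * Real.exp (-u ^ 2 / (2 * r))

lemma HK_pos {r : ℝ} (hr : 0 < r) (u : ℝ) : 0 < HK r u := by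
  unfold HK; positivity

lemma HK_le {r : ℝ} (hr : 0 < r) (u : ℝ) : HK r u ≤ (Real.sqrt (2 * Real.pi * r))⁻¹ := by
  unfold HK
  have h : Real.exp (-u ^ 2 / (2 * r)) ≤ 1 := by
    apply Real.exp_le_one_iff.2
    apply div_nonpos_of_nonpos_of_nonneg
    · nlinarith [sq_nonneg u]
    · positivity
  exact mul_le_of_le_one_right (by positivity) h

lemma HK_cont (r : ℝ) : Continuous (HK r) := by
  unfold HK; fun_prop

lemma poly_le_exp {m c : ℝ} (hm : 0 < m) (hc : 0 < c) :
    ∃ C : ℝ, 0 < C ∧ ∀ w : ℝ, 0 ≤ w → (w + 1) ^ m ≤ C * Real.exp (c * w) := by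
  refine ⟨(m / c) ^ m * Real.exp c, by positivity, fun w hw => ?_⟩
  have h1 : w + 1 ≤ (m / c) * Real.exp ((w + 1) * c / m) := by
    have := Real.add_one_le_exp ((w + 1) * c / m)
    have h2 : (w + 1) * c / m ≤ Real.exp ((w + 1) * c / m) := by linarith
    calc w + 1 = (m / c) * ((w + 1) * c / m) := by field_simp
      _ ≤ _ := by gcongr
  calc (w + 1) ^ m ≤ ((m / c) * Real.exp ((w + 1) * c / m)) ^ m := by
        apply Real.rpow_le_rpow (by linarith) h1 hm.le
    _ = (m / c) ^ m * Real.exp ((w + 1) * c) := by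
        rw [Real.mul_rpow (by positivity) (by positivity), ← Real.exp_mul]
        congr 2; field_simp
    _ = _ := by rw [mul_assoc, ← Real.exp_add]; congr 2; ring

/-- Uniform comparison of kernels. -/
lemma HK_comp {a b s m : ℝ} (ha : 0 < a) (hab : a ≤ b) (hbs : b < s) (hm : 0 < m) :
    ∃ C : ℝ, 0 < C ∧ ∀ r, a ≤ r → r ≤ b → ∀ u, (u ^ 2 + 1) ^ m * HK r u ≤ C * HK s u := by
  have hb : 0 < b := by linarith
  have hs : 0 < s := by linarith
  have hc : 0 < 1 / (2 * b) - 1 / (2 * s) := by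
    apply sub_pos.2
    apply one_div_lt_one_div_of_lt <;> linarith
  obtain ⟨C, hC, h⟩ := poly_le_exp hm hc
  refine ⟨C * ((Real.sqrt (2 * Real.pi * a))⁻¹ * Real.sqrt (2 * Real.pi * s)), by positivity, ?_⟩
  intro r har hrb u
  have hr : 0 < r := by linarith
  have h1 : (Real.sqrt (2 * Real.pi * r))⁻¹ ≤ (Real.sqrt (2 * Real.pi * a))⁻¹ := by
    gcongr
  have h2 : Real.exp (-u ^ 2 / (2 * r)) ≤ Real.exp (-u ^ 2 / (2 * b)) := by
    apply Real.exp_le_exp.2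
    rw [neg_div, neg_div]
    apply neg_le_neg
    gcongr
  have h3 := h (u ^ 2) (sq_nonneg u)
  have h4 : Real.exp ((1 / (2 * b) - 1 / (2 * s)) * u ^ 2) * Real.exp (-u ^ 2 / (2 * b))
      = Real.exp (-u ^ 2 / (2 * s)) := by
    rw [← Real.exp_add]; congr 1; field_simp; ring
  have hsq : Real.sqrt (2 * Real.pi * s) * (Real.sqrt (2 * Real.pi * s))⁻¹ = 1 :=
    mul_inv_cancel₀ (by positivity)
  unfold HK
  calc (u ^ 2 + 1) ^ m * ((Real.sqrt (2 * Real.pi * r))⁻¹ * Real.exp (-u ^ 2 / (2 * r)))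
      ≤ (C * Real.exp ((1 / (2 * b) - 1 / (2 * s)) * u ^ 2)) *
        ((Real.sqrt (2 * Real.pi * a))⁻¹ * Real.exp (-u ^ 2 / (2 * b))) := by gcongr
    _ = C * (Real.sqrt (2 * Real.pi * a))⁻¹ * Real.exp (-u ^ 2 / (2 * s)) := by
        rw [← h4]; ring
    _ = C * (Real.sqrt (2 * Real.pi * a))⁻¹ *
        (Real.sqrt (2 * Real.pi * s) * (Real.sqrt (2 * Real.pi * s))⁻¹) *
          Real.exp (-u ^ 2 / (2 * s)) := by rw [hsq]; ring
    _ = _ := by ring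

lemma HK_comp1 {a b s : ℝ} (ha : 0 < a) (hab : a ≤ b) (hbs : b < s) :
    ∃ C : ℝ, 0 < C ∧ ∀ r, a ≤ r → r ≤ b → ∀ u, (u ^ 2 + 1) * HK r u ≤ C * HK s u := by
  simpa using HK_comp (m := 1) ha hab hbs one_pos

lemma HK_bdd {a b : ℝ} (ha : 0 < a) (hab : a ≤ b) :
    ∃ C : ℝ, 0 < C ∧ ∀ r, a ≤ r → r ≤ b → ∀ u, (u ^ 2 + 1) * HK r u ≤ C := by
  obtain ⟨C, hC, h⟩ := HK_comp1 (s := b + 1) ha hab (by linarith)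
  have : 0 < b + 1 := by linarith
  refine ⟨C * (Real.sqrt (2 * Real.pi * (b + 1)))⁻¹, by positivity, fun r h1 h2 u => ?_⟩
  exact (h r h1 h2 u).trans (by gcongr; exact HK_le this u)

lemma HK_hasDerivAt_x (r u : ℝ) :
    HasDerivAt (HK r) (-(u / r) * HK r u) u := by
  unfold HK
  have h : HasDerivAt (fun u : ℝ => -u ^ 2 / (2 * r)) (-(u / r)) u := by
    have := ((hasDerivAt_pow 2 u).neg).div_const (2 * r)
    refine this.congr_deriv ?_
    norm_num
    rw [neg_div, mul_div_mul_left _ _ (two_ne_zero)]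
  refine ((h.exp).const_mul ((Real.sqrt (2 * Real.pi * r))⁻¹)).congr_deriv ?_
  ring

lemma HK_hasDerivAt_xx (r u : ℝ) :
    HasDerivAt (fun u => -(u / r) * HK r u) ((u ^ 2 / r ^ 2 - 1 / r) * HK r u) u := by
  have h := (((hasDerivAt_id u).div_const r).neg).mul (HK_hasDerivAt_x r u)
  refine h.congr_deriv ?_
  simp only [id, Pi.neg_apply]; ring

lemma HK_hasDerivAt_t {r : ℝ} (hr : 0 < r) (u : ℝ) :
    HasDerivAt (fun r => HK r u) (1 / 2 * ((u ^ 2 / r ^ 2 - 1 / r) * HK r u)) r := by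
  unfold HK
  have h0 : HasDerivAt (fun r : ℝ => 2 * Real.pi * r) (2 * Real.pi) r := by
    simpa using (hasDerivAt_id r).const_mul (2 * Real.pi)
  have hpos : 0 < 2 * Real.pi * r := by positivity
  have h1 := (h0.sqrt hpos.ne').inv (Real.sqrt_pos.2 hpos).ne'
  have h2 : HasDerivAt (fun r : ℝ => -u ^ 2 / (2 * r)) (u ^ 2 / (2 * r ^ 2)) r := by
    have h3 : HasDerivAt (fun r : ℝ => 2 * r) 2 r := by
      simpa using (hasDerivAt_id r).const_mul (2 : ℝ)
    have := (hasDerivAt_const r (-u ^ 2)).div h3 (by positivity)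
    refine this.congr_deriv ?_
    field_simp; ring
  refine (h1.mul h2.exp).congr_deriv ?_
  have hs : Real.sqrt (2 * Real.pi * r) ^ 2 = 2 * Real.pi * r := Real.sq_sqrt hpos.le
  rw [hs]
  simp only [Pi.inv_apply]
  field_simp
  ring

lemma integrable_f {f : ℝ → ℝ} (hf1 : (∫ x : ℝ, f x) = 1) : Integrable f := by
  by_contra h
  rw [integral_undef h] at hf1
  norm_num at hf1

lemma int_bdd {f g : ℝ → ℝ} (hf : Integrable f) (hg : Continuous g) (C : ℝ)
    (h : ∀ y, |g y| ≤ C) : Integrable (fun y => f y * g y) :=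
  hf.mul_bdd (c := C) hg.aestronglyMeasurable (ae_of_all _ h)

lemma heatP_eq (f : ℝ → ℝ) (t x : ℝ) : heatP f t x = ∫ y, f y * HK t (x - y) := rfl

noncomputable def heatQ (f : ℝ → ℝ) (t x : ℝ) : ℝ :=
  ∫ y, f y * (((x - y) ^ 2 + 1) * HK t (x - y))

noncomputable def heat1 (f : ℝ → ℝ) (t x : ℝ) : ℝ :=
  ∫ y, f y * (-((x - y) / t) * HK t (x - y))

noncomputable def heat2 (f : ℝ → ℝ) (t x : ℝ) : ℝ :=
  ∫ y, f y * (((x - y) ^ 2 / t ^ 2 - 1 / t) * HK t (x - y))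

lemma int_P {f : ℝ → ℝ} (hf : Integrable f) {t : ℝ} (ht : 0 < t) (x : ℝ) :
    Integrable (fun y => f y * HK t (x - y)) :=
  int_bdd hf ((HK_cont t).comp (by fun_prop)) _ (fun y => by
    rw [abs_of_pos (HK_pos ht _)]; exact HK_le ht _)

lemma int_Q {f : ℝ → ℝ} (hf : Integrable f) {t : ℝ} (ht : 0 < t) (x : ℝ) :
    Integrable (fun y => f y * (((x - y) ^ 2 + 1) * HK t (x - y))) := by
  obtain ⟨C, hC, h⟩ := HK_bdd ht le_rfl
  have hk := HK_cont t
  refine int_bdd hf (by fun_prop) C (fun y => ?_)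
  have := HK_pos ht (x - y)
  rw [abs_of_nonneg (by positivity)]; exact h t le_rfl le_rfl _

lemma bound1 {a t : ℝ} (ha : 0 < a) (hat : a ≤ t) (u : ℝ) :
    |-(u / t) * HK t u| ≤ (1 / a + 1 / a ^ 2) * ((u ^ 2 + 1) * HK t u) := by
  have ht : 0 < t := by linarith
  have := HK_pos ht u
  rw [abs_mul, abs_of_pos this, abs_neg, abs_div, abs_of_pos ht, ← mul_assoc]
  gcongr
  have h1 : |u| ≤ u ^ 2 + 1 := by
    apply abs_le.2; constructor <;> nlinarith [sq_nonneg (u + 1), sq_nonneg (u - 1)]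
  calc |u| / t ≤ (u ^ 2 + 1) / a := by gcongr
    _ ≤ (1 / a + 1 / a ^ 2) * (u ^ 2 + 1) := by
      have : 0 ≤ 1 / a ^ 2 * (u ^ 2 + 1) := by positivity
      have e : (1 / a + 1 / a ^ 2) * (u ^ 2 + 1) = (u ^ 2 + 1) / a + 1 / a ^ 2 * (u ^ 2 + 1) := by ring
      linarith

lemma bound2 {a t : ℝ} (ha : 0 < a) (hat : a ≤ t) (u : ℝ) :
    |(u ^ 2 / t ^ 2 - 1 / t) * HK t u| ≤ (1 / a + 1 / a ^ 2) * ((u ^ 2 + 1) * HK t u) := by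
  have ht : 0 < t := by linarith
  have := HK_pos ht u
  rw [abs_mul, abs_of_pos this, ← mul_assoc]
  gcongr
  have h1 : u ^ 2 / t ^ 2 ≤ u ^ 2 / a ^ 2 := by gcongr
  have h2 : 1 / t ≤ 1 / a := by gcongr
  have h3 : 0 ≤ u ^ 2 / t ^ 2 := by positivity
  have h4 : 0 ≤ 1 / t := by positivity
  have h5 : 0 ≤ u ^ 2 / a := by positivity
  have h6 : 0 ≤ 1 / a ^ 2 := by positivity
  have h7 : 0 ≤ 1 / a := by positivity
  have e : (1 / a + 1 / a ^ 2) * (u ^ 2 + 1) = u ^ 2 / a + 1 / a + (u ^ 2 / a ^ 2 + 1 / a ^ 2) := by ring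
  rw [e]
  apply abs_le.2
  have h8 : 0 ≤ u ^ 2 / a ^ 2 := by positivity
  constructor <;> linarith

lemma int_1 {f : ℝ → ℝ} (hf : Integrable f) {t : ℝ} (ht : 0 < t) (x : ℝ) :
    Integrable (fun y => f y * (-((x - y) / t) * HK t (x - y))) := by
  obtain ⟨C, hC, h⟩ := HK_bdd ht le_rfl
  have hk := HK_cont t
  refine int_bdd hf (by fun_prop) ((1 / t + 1 / t ^ 2) * C) (fun y => ?_)
  refine (bound1 ht le_rfl _).trans ?_
  gcongr
  exact h t le_rfl le_rfl _

lemma int_2 {f : ℝ → ℝ} (hf : Integrable f) {t : ℝ} (ht : 0 < t) (x : ℝ) :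
    Integrable (fun y => f y * (((x - y) ^ 2 / t ^ 2 - 1 / t) * HK t (x - y))) := by
  obtain ⟨C, hC, h⟩ := HK_bdd ht le_rfl
  have hk := HK_cont t
  refine int_bdd hf (by fun_prop) ((1 / t + 1 / t ^ 2) * C) (fun y => ?_)
  refine (bound2 ht le_rfl _).trans ?_
  gcongr
  exact h t le_rfl le_rfl _

lemma heatP_hasDerivAt_x {f : ℝ → ℝ} (hf : Integrable f) {t : ℝ} (ht : 0 < t) (x : ℝ) :
    HasDerivAt (heatP f t) (heat1 f t x) x := by
  obtain ⟨C, hC, h⟩ := HK_bdd ht le_rfl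
  refine (hasDerivAt_integral_of_dominated_loc_of_deriv_le (μ := volume)
    (F := fun x y => f y * HK t (x - y))
    (F' := fun x y => f y * (-((x - y) / t) * HK t (x - y)))
    (bound := fun y => |f y| * ((1 / t + 1 / t ^ 2) * C)) Filter.univ_mem
    (Eventually.of_forall fun x => (int_P hf ht x).aestronglyMeasurable)
    (int_P hf ht x) (int_1 hf ht x).aestronglyMeasurable ?_ (hf.abs.mul_const _) ?_).2
  · refine ae_of_all _ fun y x _ => ?_
    rw [Real.norm_eq_abs, abs_mul]
    gcongr
    refine (bound1 ht le_rfl _).trans ?_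
    gcongr
    exact h t le_rfl le_rfl _
  · refine ae_of_all _ fun y x _ => ?_
    exact ((HK_hasDerivAt_x t (x - y)).comp_sub_const x y).const_mul (f y)

lemma heat1_hasDerivAt_x {f : ℝ → ℝ} (hf : Integrable f) {t : ℝ} (ht : 0 < t) (x : ℝ) :
    HasDerivAt (heat1 f t) (heat2 f t x) x := by
  obtain ⟨C, hC, h⟩ := HK_bdd ht le_rfl
  refine (hasDerivAt_integral_of_dominated_loc_of_deriv_le (μ := volume)
    (F := fun x y => f y * (-((x - y) / t) * HK t (x - y)))
    (F' := fun x y => f y * (((x - y) ^ 2 / t ^ 2 - 1 / t) * HK t (x - y)))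
    (bound := fun y => |f y| * ((1 / t + 1 / t ^ 2) * C)) Filter.univ_mem
    (Eventually.of_forall fun x => (int_1 hf ht x).aestronglyMeasurable)
    (int_1 hf ht x) (int_2 hf ht x).aestronglyMeasurable ?_ (hf.abs.mul_const _) ?_).2
  · refine ae_of_all _ fun y x _ => ?_
    rw [Real.norm_eq_abs, abs_mul]
    gcongr
    refine (bound2 ht le_rfl _).trans ?_
    gcongr
    exact h t le_rfl le_rfl _
  · refine ae_of_all _ fun y x _ => ?_
    exact ((HK_hasDerivAt_xx t (x - y)).comp_sub_const x y).const_mul (f y)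

lemma heatP_hasDerivAt_t {f : ℝ → ℝ} (hf : Integrable f) {t : ℝ} (ht : 0 < t) (x : ℝ) :
    HasDerivAt (fun t => heatP f t x) (1 / 2 * heat2 f t x) t := by
  have ha : 0 < t / 2 := by linarith
  obtain ⟨C, hC, h⟩ := HK_bdd ha (show t / 2 ≤ t + 1 by linarith)
  have hev : Set.Ioo (t / 2) (t + 1) ∈ nhds t := Ioo_mem_nhds (by linarith) (by linarith)
  have key := (hasDerivAt_integral_of_dominated_loc_of_deriv_le (μ := volume)
    (F := fun t y => f y * HK t (x - y))
    (F' := fun t y => f y * (1 / 2 * (((x - y) ^ 2 / t ^ 2 - 1 / t) * HK t (x - y))))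
    (bound := fun y => |f y| * ((1 / (t / 2) + 1 / (t / 2) ^ 2) * C)) hev
    (by
      filter_upwards [hev] with r hr
      exact (int_P hf (ha.trans hr.1) x).aestronglyMeasurable)
    (int_P hf ht x) ?_ ?_ (hf.abs.mul_const _) ?_).2
  · refine key.congr_deriv ?_
    unfold heat2
    rw [← integral_const_mul]
    congr 1; ext y; ring
  · have := ((int_2 hf ht x).const_mul (1 / 2)).aestronglyMeasurable
    convert this using 1
    ext y; ring
  · refine ae_of_all _ fun y r hr => ?_
    rw [Real.norm_eq_abs, abs_mul]
    gcongr
    rw [abs_mul, abs_of_pos (by norm_num : (0 : ℝ) < 1 / 2)]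
    have h1 := bound2 ha hr.1.le (x - y)
    have h2 : (1 / (t / 2) + 1 / (t / 2) ^ 2) * (((x - y) ^ 2 + 1) * HK r (x - y)) ≤
      (1 / (t / 2) + 1 / (t / 2) ^ 2) * C := by
      gcongr
      exact h r hr.1.le hr.2.le _
    have h3 := abs_nonneg (((x - y) ^ 2 / r ^ 2 - 1 / r) * HK r (x - y))
    linarith
  · refine ae_of_all _ fun y r hr => ?_
    exact (HK_hasDerivAt_t (ha.trans hr.1) (x - y)).const_mul (f y)

lemma heatP_pos {f : ℝ → ℝ} (hf0 : ∀ x, 0 ≤ f x) (hf1 : (∫ x : ℝ, f x) = 1)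
    {t : ℝ} (ht : 0 < t) (x : ℝ) : 0 < heatP f t x := by
  have hf := integrable_f hf1
  rw [heatP_eq, integral_pos_iff_support_of_nonneg
    (fun y => mul_nonneg (hf0 y) (HK_pos ht _).le) (int_P hf ht x)]
  have h1 : 0 < ∫ x, f x := by rw [hf1]; norm_num
  rw [integral_pos_iff_support_of_nonneg hf0 hf] at h1
  convert h1 using 2
  ext y
  simp [(HK_pos ht (x - y)).ne']

lemma heat1_le {f : ℝ → ℝ} (hf0 : ∀ x, 0 ≤ f x) (hf : Integrable f)
    {a t : ℝ} (ha : 0 < a) (hat : a ≤ t) (x : ℝ) :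
    |heat1 f t x| ≤ (1 / a + 1 / a ^ 2) * heatQ f t x := by
  have ht : 0 < t := by linarith
  unfold heat1 heatQ
  rw [← integral_const_mul]
  refine (abs_integral_le_integral_abs).trans ?_
  refine integral_mono (int_1 hf ht x).abs ((int_Q hf ht x).const_mul _) fun y => ?_
  simp only
  rw [abs_mul, abs_of_nonneg (hf0 y), mul_left_comm]
  exact mul_le_mul_of_nonneg_left (bound1 ha hat _) (hf0 y)

lemma heat2_le {f : ℝ → ℝ} (hf0 : ∀ x, 0 ≤ f x) (hf : Integrable f)
    {a t : ℝ} (ha : 0 < a) (hat : a ≤ t) (x : ℝ) :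
    |heat2 f t x| ≤ (1 / a + 1 / a ^ 2) * heatQ f t x := by
  have ht : 0 < t := by linarith
  unfold heat2 heatQ
  rw [← integral_const_mul]
  refine (abs_integral_le_integral_abs).trans ?_
  refine integral_mono (int_2 hf ht x).abs ((int_Q hf ht x).const_mul _) fun y => ?_
  simp only
  rw [abs_mul, abs_of_nonneg (hf0 y), mul_left_comm]
  exact mul_le_mul_of_nonneg_left (bound2 ha hat _) (hf0 y)

lemma heatQ_nonneg {f : ℝ → ℝ} (hf0 : ∀ x, 0 ≤ f x) {t : ℝ} (ht : 0 < t) (x : ℝ) :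
    0 ≤ heatQ f t x :=
  integral_nonneg fun y => mul_nonneg (hf0 y) (mul_nonneg (by positivity) (HK_pos ht _).le)

lemma heatP_le_Q {f : ℝ → ℝ} (hf0 : ∀ x, 0 ≤ f x) (hf : Integrable f) {t : ℝ} (ht : 0 < t) (x : ℝ) :
    heatP f t x ≤ heatQ f t x := by
  refine integral_mono (int_P hf ht x) (int_Q hf ht x) fun y => ?_
  refine mul_le_mul_of_nonneg_left ?_ (hf0 y)
  have := HK_pos ht (x - y)
  change HK t (x - y) ≤ _
  nlinarith [mul_nonneg (sq_nonneg (x - y)) this.le]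

/-- Cauchy–Schwarz. -/
lemma heat1_sq_le {f : ℝ → ℝ} (hf0 : ∀ x, 0 ≤ f x) (hf1 : (∫ x : ℝ, f x) = 1)
    {t : ℝ} (ht : 0 < t) (x : ℝ) :
    (heat1 f t x) ^ 2 ≤ 1 / t ^ 2 * (heatP f t x * heatQ f t x) := by
  have hf := integrable_f hf1
  have hP := heatP_pos hf0 hf1 ht x
  set c := t * heat1 f t x / heatP f t x with hc
  have h0 : 0 ≤ ∫ y, f y * (((x - y) + c) ^ 2 * HK t (x - y)) :=
    integral_nonneg fun y => mul_nonneg (hf0 y) (mul_nonneg (by positivity) (HK_pos ht _).le)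
  have h1 : ∫ y, f y * (((x - y) + c) ^ 2 * HK t (x - y)) =
      heatQ f t x - 2 * c * t * heat1 f t x + (c ^ 2 - 1) * heatP f t x := by
    unfold heatQ heat1
    rw [heatP_eq, ← integral_const_mul, ← integral_const_mul, ← integral_sub, ← integral_add]
    · congr 1; ext y; field_simp; ring
    · exact (int_Q hf ht x).sub ((int_1 hf ht x).const_mul _)
    · exact (int_P hf ht x).const_mul _
    · exact int_Q hf ht x
    · exact (int_1 hf ht x).const_mul _
  rw [h1] at h0
  have h2 : heatQ f t x - 2 * c * t * heat1 f t x + (c ^ 2 - 1) * heatP f t x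
      = heatQ f t x - t ^ 2 * heat1 f t x ^ 2 / heatP f t x - heatP f t x := by
    rw [hc]; field_simp; ring
  rw [h2] at h0
  have h3 : t ^ 2 * heat1 f t x ^ 2 / heatP f t x ≤ heatQ f t x := by linarith
  rw [div_le_iff₀ hP] at h3
  rw [one_div, inv_mul_eq_div, le_div_iff₀ (by positivity)]
  linarith

/-- Key domination. -/
lemma key_dom {f : ℝ → ℝ} (hf0 : ∀ x, 0 ≤ f x) (hf1 : (∫ x : ℝ, f x) = 1)
    {α : ℝ} (hα : 0 < α) {a b s : ℝ} (ha : 0 < a) (hab : a ≤ b) (hbs : b < s) :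
    ∃ C : ℝ, 0 < C ∧ ∀ r, a ≤ r → r ≤ b → ∀ x,
      heatP f r x ^ (α - 1) * heatQ f r x ≤ C * heatP f s x ^ α := by
  have hf := integrable_f hf1
  have hs : 0 < s := by linarith
  rcases le_or_gt 1 α with h1 | h1
  · obtain ⟨C, hC, h⟩ := HK_comp1 ha hab hbs
    refine ⟨C ^ α, by positivity, fun r har hrb x => ?_⟩
    have hr : 0 < r := by linarith
    have hQ : heatQ f r x ≤ C * heatP f s x := by
      rw [heatP_eq, ← integral_const_mul]
      refine integral_mono (int_Q hf hr x) ((int_P hf hs x).const_mul _) fun y => ?_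
      simp only
      rw [mul_left_comm C]
      exact mul_le_mul_of_nonneg_left (h r har hrb _) (hf0 y)
    have hP : heatP f r x ≤ C * heatP f s x := (heatP_le_Q hf0 hf hr x).trans hQ
    have h0 := heatP_pos hf0 hf1 hr x
    have h0s := heatP_pos hf0 hf1 hs x
    calc heatP f r x ^ (α - 1) * heatQ f r x
        ≤ (C * heatP f s x) ^ (α - 1) * (C * heatP f s x) := by
          have := heatQ_nonneg hf0 hr x
          have : 0 ≤ α - 1 := by linarith
          gcongr
      _ = (C * heatP f s x) ^ α := by
          rw [← Real.rpow_add_one (by positivity)]; congr 1; ring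
      _ = _ := Real.mul_rpow hC.le h0s.le
  · obtain ⟨C, hC, h⟩ := HK_comp (m := 1 / α) ha hab hbs (by positivity)
    refine ⟨1 + C, by positivity, fun r har hrb x => ?_⟩
    have hr : 0 < r := by linarith
    have h0 := heatP_pos hf0 hf1 hr x
    have h0s := heatP_pos hf0 hf1 hs x
    set P := heatP f r x with hP
    set S := heatP f s x with hS
    set l := (S / P) ^ α with hl
    have hlpos : 0 < l := by positivity
    have hw : ∀ w : ℝ, 0 < w → w ≤ l + l ^ (1 - 1 / α) * w ^ (1 / α) := by
      intro w hw
      rcases le_total w l with h | h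
      · have : 0 ≤ l ^ (1 - 1 / α) * w ^ (1 / α) := by positivity
        linarith
      · have h2 : 1 ≤ 1 / α := by rw [le_div_iff₀ hα]; linarith
        have h3 : w / l ≤ (w / l) ^ (1 / α) := by
          have := Real.rpow_le_rpow_of_exponent_le ((one_le_div hlpos).2 h) h2
          simpa using this
        have h4 : l ^ (1 - 1 / α) * w ^ (1 / α) = l * (w / l) ^ (1 / α) := by
          rw [Real.div_rpow hw.le hlpos.le, Real.rpow_sub hlpos, Real.rpow_one]; ring
        have h5 : w = l * (w / l) := by field_simp
        rw [h4]
        have := mul_le_mul_of_nonneg_left h3 hlpos.le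
        linarith
    have hQ : heatQ f r x ≤ l * P + l ^ (1 - 1 / α) * C * S := by
      rw [hP, hS, heatP_eq, heatP_eq, ← integral_const_mul, ← integral_const_mul, ← integral_add
        ((int_P hf hr x).const_mul _) ((int_P hf hs x).const_mul _)]
      refine integral_mono (int_Q hf hr x)
        (((int_P hf hr x).const_mul _).add ((int_P hf hs x).const_mul _)) fun y => ?_
      have hK := HK_pos hr (x - y)
      have e1 : ((x - y) ^ 2 + 1) * HK r (x - y) ≤
          l * HK r (x - y) + l ^ (1 - 1 / α) * (C * HK s (x - y)) := by
        calc ((x - y) ^ 2 + 1) * HK r (x - y)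
            ≤ (l + l ^ (1 - 1 / α) * ((x - y) ^ 2 + 1) ^ (1 / α)) * HK r (x - y) := by
              exact mul_le_mul_of_nonneg_right (hw _ (by nlinarith [sq_nonneg (x - y)])) hK.le
          _ = l * HK r (x - y) + l ^ (1 - 1 / α) * (((x - y) ^ 2 + 1) ^ (1 / α) * HK r (x - y)) := by
              ring
          _ ≤ _ := by
              have := mul_le_mul_of_nonneg_left (h r har hrb (x - y))
                (Real.rpow_pos_of_pos hlpos (1 - 1 / α)).le
              linarith
      have e2 := mul_le_mul_of_nonneg_left e1 (hf0 y)
      simp only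
      linarith
    have e1 : P ^ (α - 1) * (l * P) = S ^ α := by
      rw [hl, Real.div_rpow h0s.le h0.le, Real.rpow_sub_one h0.ne']
      field_simp
    have e2 : P ^ (α - 1) * (l ^ (1 - 1 / α) * C * S) = C * S ^ α := by
      have : l ^ (1 - 1 / α) = (S / P) ^ (α - 1) := by
        rw [hl, ← Real.rpow_mul (by positivity)]; congr 1; field_simp
      rw [this, Real.div_rpow h0s.le h0.le, Real.rpow_sub_one h0s.ne']
      field_simp
    calc P ^ (α - 1) * heatQ f r x ≤ P ^ (α - 1) * (l * P + l ^ (1 - 1 / α) * C * S) := by gcongr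
      _ = _ := by rw [mul_add, e1, e2]; ring

lemma heatP_cont {f : ℝ → ℝ} (hf : Integrable f) {t : ℝ} (ht : 0 < t) : Continuous (heatP f t) :=
  continuous_iff_continuousAt.2 fun x => (heatP_hasDerivAt_x hf ht x).continuousAt

lemma heat1_cont {f : ℝ → ℝ} (hf : Integrable f) {t : ℝ} (ht : 0 < t) : Continuous (heat1 f t) :=
  continuous_iff_continuousAt.2 fun x => (heat1_hasDerivAt_x hf ht x).continuousAt

lemma heat2_meas {f : ℝ → ℝ} (hf : Integrable f) {t : ℝ} (ht : 0 < t) : Measurable (heat2 f t) := by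
  have : heat2 f t = deriv (heat1 f t) := by
    ext x; exact (heat1_hasDerivAt_x hf ht x).deriv.symm
  rw [this]; exact measurable_deriv _

lemma main_aux {f : ℝ → ℝ} (hf0 : ∀ x, 0 ≤ f x) (hf1 : (∫ x : ℝ, f x) = 1)
    {α : ℝ} (hα : 0 < α) {t s : ℝ} (ht : 0 < t) (hts : t < s)
    (hIntS : Integrable (fun x => heatP f s x ^ α)) :
    HasDerivAt (fun r => ∫ x, heatP f r x ^ α)
      (-(α / 2 * (α - 1)) * ∫ x, heatP f t x ^ (α - 2) * (heat1 f t x) ^ 2) t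
      ∧ 0 < ∫ x, heatP f t x ^ α := by
  have hf := integrable_f hf1
  have ha : 0 < t / 2 := by linarith
  have hs : 0 < s := by linarith
  obtain ⟨C, hC, h⟩ := key_dom hf0 hf1 hα ha (show t / 2 ≤ (t + s) / 2 by linarith)
    (show (t + s) / 2 < s by linarith)
  have hev : Set.Ioo (t / 2) ((t + s) / 2) ∈ nhds t := Ioo_mem_nhds (by linarith) (by linarith)
  set D := 1 / (t / 2) + 1 / (t / 2) ^ 2 with hD
  have hDpos : 0 < D := by positivity
  have hPc := heatP_cont hf ht
  have hpos : ∀ x, 0 < heatP f t x := heatP_pos hf0 hf1 ht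
  have hrc : ∀ {r : ℝ}, 0 < r → ∀ β : ℝ, Continuous fun x => heatP f r x ^ β := fun hr β =>
    (heatP_cont hf hr).rpow_const fun x => Or.inl (heatP_pos hf0 hf1 hr x).ne'
  have ht1 : t / 2 ≤ t := by linarith
  have ht2 : t ≤ (t + s) / 2 := by linarith
  -- integrability
  have iP : Integrable (fun x => heatP f t x ^ α) := by
    refine (hIntS.const_mul C).mono' (hrc ht α).aestronglyMeasurable (ae_of_all _ fun x => ?_)
    have := hpos x
    rw [Real.norm_eq_abs, abs_of_pos (by positivity)]
    refine le_trans ?_ (h t ht1 ht2 x)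
    calc heatP f t x ^ α = heatP f t x ^ (α - 1) * heatP f t x := by
          rw [Real.rpow_sub_one this.ne']; field_simp
      _ ≤ _ := by
          gcongr
          exact heatP_le_Q hf0 hf ht x
  have gen : ∀ (g : ℝ → ℝ), Measurable g → (∀ x, |g x| ≤ D * heatQ f t x) →
      Integrable (fun x => heatP f t x ^ (α - 1) * g x) := by
    intro g hg hb
    refine (hIntS.const_mul (D * C)).mono'
      ((hrc ht _).measurable.mul hg).aestronglyMeasurable (ae_of_all _ fun x => ?_)
    have := hpos x
    rw [Real.norm_eq_abs, abs_mul, abs_of_pos (by positivity)]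
    calc heatP f t x ^ (α - 1) * |g x| ≤ heatP f t x ^ (α - 1) * (D * heatQ f t x) := by
          gcongr; exact hb x
      _ = D * (heatP f t x ^ (α - 1) * heatQ f t x) := by ring
      _ ≤ D * (C * heatP f s x ^ α) := mul_le_mul_of_nonneg_left (h t ht1 ht2 x) hDpos.le
      _ = _ := by ring
  have i1 := gen (heat1 f t) (heat1_cont hf ht).measurable (heat1_le hf0 hf ha ht1)
  have i2 := gen (heat2 f t) (heat2_meas hf ht) (heat2_le hf0 hf ha ht1)
  have i3 := gen (fun x => heat1 f t x ^ 2 / heatP f t x)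
    (((heat1_cont hf ht).measurable.pow_const 2).div hPc.measurable) (by
      intro x
      have := hpos x
      have hQ := heatQ_nonneg hf0 ht x
      rw [abs_of_nonneg (by positivity), div_le_iff₀ this]
      refine (heat1_sq_le hf0 hf1 ht x).trans ?_
      have e : 1 / t ^ 2 ≤ D := by
        have : 1 / t ^ 2 ≤ 1 / (t / 2) ^ 2 := by gcongr
        have : 0 < 1 / (t / 2) := by positivity
        linarith
      calc 1 / t ^ 2 * (heatP f t x * heatQ f t x) ≤ D * (heatP f t x * heatQ f t x) := by gcongr
        _ = _ := by ring)
  have e3 : ∀ x, heatP f t x ^ (α - 1) * (heat1 f t x ^ 2 / heatP f t x)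
      = heatP f t x ^ (α - 2) * heat1 f t x ^ 2 := by
    intro x
    have : α - 2 = α - 1 - 1 := by ring
    rw [this, Real.rpow_sub_one (hpos x).ne' (α - 1)]; ring
  simp only [e3] at i3
  -- integration by parts
  have ibp : ∫ x, heatP f t x ^ (α - 1) * heat2 f t x
      = -((α - 1) * ∫ x, heatP f t x ^ (α - 2) * heat1 f t x ^ 2) := by
    have hu : ∀ x, HasDerivAt (fun x => heatP f t x ^ (α - 1))
        ((α - 1) * heatP f t x ^ (α - 2) * heat1 f t x) x := by
      intro x
      have := (heatP_hasDerivAt_x hf ht x).rpow_const (p := α - 1) (Or.inl (hpos x).ne')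
      refine this.congr_deriv ?_
      have : α - 1 - 1 = α - 2 := by ring
      rw [this]; ring
    have e4 : ∀ x, (α - 1) * heatP f t x ^ (α - 2) * heat1 f t x * heat1 f t x
        = (α - 1) * (heatP f t x ^ (α - 2) * heat1 f t x ^ 2) := fun x => by ring
    have := integral_mul_deriv_eq_deriv_mul_of_integrable
      (u := fun x => heatP f t x ^ (α - 1)) (v := heat1 f t)
      (u' := fun x => (α - 1) * heatP f t x ^ (α - 2) * heat1 f t x) (v' := heat2 f t)
      (fun x _ => hu x) (fun x _ => heat1_hasDerivAt_x hf ht x) i2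
      (by
        refine (i3.const_mul (α - 1)).congr (ae_of_all _ fun x => ?_)
        exact (e4 x).symm) i1
    rw [this]
    simp only [e4]
    rw [integral_const_mul]
  refine ⟨?_, ?_⟩
  · have key := (hasDerivAt_integral_of_dominated_loc_of_deriv_le (μ := volume)
      (F := fun r x => heatP f r x ^ α)
      (F' := fun r x => α / 2 * (heatP f r x ^ (α - 1) * heat2 f r x))
      (bound := fun x => (α / 2 * (D * C)) * heatP f s x ^ α) hev
      (by
        filter_upwards [hev] with r hr
        exact (hrc (ha.trans hr.1) α).aestronglyMeasurable)
      iP (i2.const_mul _).aestronglyMeasurable ?_ (hIntS.const_mul _) ?_).2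
    · refine key.congr_deriv ?_
      rw [integral_const_mul, ibp]; ring
    · refine ae_of_all _ fun x r hr => ?_
      have hr0 : 0 < r := ha.trans hr.1
      have := heatP_pos hf0 hf1 hr0 x
      rw [Real.norm_eq_abs, abs_mul, abs_mul, abs_of_pos (by positivity : 0 < α / 2),
        abs_of_pos (by positivity : 0 < heatP f r x ^ (α - 1)), mul_assoc]
      refine mul_le_mul_of_nonneg_left ?_ (by positivity)
      calc heatP f r x ^ (α - 1) * |heat2 f r x| ≤ heatP f r x ^ (α - 1) * (D * heatQ f r x) := by
            gcongr; exact heat2_le hf0 hf ha hr.1.le x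
        _ = D * (heatP f r x ^ (α - 1) * heatQ f r x) := by ring
        _ ≤ D * (C * heatP f s x ^ α) :=
            mul_le_mul_of_nonneg_left (h r hr.1.le hr.2.le x) hDpos.le
        _ = D * C * heatP f s x ^ α := by ring
    · refine ae_of_all _ fun x r hr => ?_
      have hr0 : 0 < r := ha.trans hr.1
      have := (heatP_hasDerivAt_t hf hr0 x).rpow_const (p := α)
        (Or.inl (heatP_pos hf0 hf1 hr0 x).ne')
      refine this.congr_deriv ?_
      ring
  · rw [integral_pos_iff_support_of_nonneg (fun x => (Real.rpow_pos_of_pos (hpos x) α).le) iP]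
    have : Function.support (fun x => heatP f t x ^ α) = Set.univ := by
      ext x; simp [(Real.rpow_pos_of_pos (hpos x) α).ne']
    rw [this]; simp

/-- First-order derivative of the Rényi entropy along the heat flow. -/
theorem renyi_first_derivative
    (f : ℝ → ℝ) (hfm : Measurable f) (hf0 : ∀ x, 0 ≤ f x)
    (hf1 : (∫ x : ℝ, f x) = 1)
    (α : ℝ) (hα : 0 < α) (hα1 : α ≠ 1)
    (t : ℝ) (ht : 0 < t) (htα : ltTalpha f α t) :
    HasDerivAt (fun s => renyiEnt f α s)
      (α / 2 * ((∫ x : ℝ, heatP f t x ^ (α - 2) * (pk f 1 t x) ^ 2) /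
        (∫ x : ℝ, heatP f t x ^ α))) t
    ∧ α / 2 * ((∫ x : ℝ, heatP f t x ^ (α - 2) * (pk f 1 t x) ^ 2) /
        (∫ x : ℝ, heatP f t x ^ α))
      = α / 2 * Ea f α t (fun x => (pbar f 1 t x) ^ 2) := by
  obtain ⟨s, hts, hs, hfin⟩ := htα
  unfold renyiFinite at hfin
  rw [if_neg hα1] at hfin
  obtain ⟨hd, hpos⟩ := main_aux hf0 hf1 hα ht hts hfin.1
  have hf := integrable_f hf1
  have hpk : ∀ x, pk f 1 t x = heat1 f t x := by
    intro x
    unfold pk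
    rw [iteratedDeriv_one]
    exact (heatP_hasDerivAt_x hf ht x).deriv
  constructor
  · simp only [hpk]
    have h1 := (hd.log hpos.ne').const_mul ((1 - α)⁻¹)
    have h2 : (fun s => renyiEnt f α s) =
        fun r => (1 - α)⁻¹ * Real.log (∫ x, heatP f r x ^ α) := by
      ext r; unfold renyiEnt; rw [if_neg hα1]
    rw [h2]
    refine h1.congr_deriv ?_
    have h3 : 1 - α ≠ 0 := sub_ne_zero.2 hα1.symm
    field_simp
    ring
  · unfold Ea pbar
    congr 3
    ext x
    have hp := heatP_pos hf0 hf1 ht x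
    have h2 : α - 2 = α - 1 - 1 := by ring
    rw [h2, Real.rpow_sub_one hp.ne', Real.rpow_sub_one hp.ne']
    field_simp
end

section
/- For every α ∈ (0,∞] and every t ∈ (0, t_α), ∂h_α(p(·,t))/∂t ≥ 0; here α = 1 means the Shannon entropy h(p(·,t)) = -∫ p log p dx and α = ∞ means the min-entropy h_∞(p(·,t)) = -log ess sup_x p(x,t). -/
open MeasureTheory Real Filter
open scoped Classical

/-- The min-entropy of the heat-flow density. -/
noncomputable def minEnt (f : ℝ → ℝ) (t : ℝ) : ℝ :=
  -Real.log (essSup (fun x => heatP f t x) volume)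


namespace RenyiAux

/-- heat kernel -/
noncomputable def G (t x y : ℝ) : ℝ :=
  (Real.sqrt (2 * Real.pi * t))⁻¹ * Real.exp (-(x - y) ^ 2 / (2 * t))

lemma G_pos {t : ℝ} (ht : 0 < t) (x y : ℝ) : 0 < G t x y := by
  unfold G; positivity

lemma G_symm (t x y : ℝ) : G t x y = G t y x := by
  unfold G; rw [show (x - y) ^ 2 = (y - x) ^ 2 by ring]

lemma G_le {t : ℝ} (ht : 0 < t) (x y : ℝ) : G t x y ≤ (Real.sqrt (2 * Real.pi * t))⁻¹ := by
  unfold G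
  apply mul_le_of_le_one_right (by positivity)
  rw [Real.exp_le_one_iff]
  apply div_nonpos_of_nonpos_of_nonneg _ (by positivity)
  nlinarith [sq_nonneg (x - y)]

lemma G_cont (t : ℝ) : Continuous (fun z : ℝ × ℝ => G t z.1 z.2) := by
  unfold G; fun_prop

lemma G_meas (t : ℝ) : Measurable (fun z : ℝ × ℝ => G t z.1 z.2) := (G_cont t).measurable

lemma G_lint {t : ℝ} (ht : 0 < t) (x : ℝ) : ∫⁻ y, ENNReal.ofReal (G t x y) = 1 := by
  have := ProbabilityTheory.lintegral_gaussianPDFReal_eq_one x (v := ⟨t, ht.le⟩)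
    (by intro h; exact ht.ne' (congrArg NNReal.toReal h))
  rw [← this]
  congr 1; ext y
  rw [G_symm]
  rfl

lemma G_mul {a b : ℝ} (ha : 0 < a) (hb : 0 < b) (x y z : ℝ) :
    G b x y * G a y z = G (a + b) x z * G (a * b / (a + b)) ((a * x + b * z) / (a + b)) y := by
  unfold G
  have hab : 0 < a + b := by positivity
  rw [mul_mul_mul_comm, mul_mul_mul_comm (√(2 * π * (a + b)))⁻¹, ← mul_inv, ← mul_inv,
    ← Real.sqrt_mul (by positivity), ← Real.sqrt_mul (by positivity), ← Real.exp_add,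
    ← Real.exp_add]
  have e1 : 2 * π * b * (2 * π * a) = 2 * π * (a + b) * (2 * π * (a * b / (a + b))) := by
    field_simp
  have e2 : -(x - y) ^ 2 / (2 * b) + -(y - z) ^ 2 / (2 * a) = -(x - z) ^ 2 / (2 * (a + b)) +
      -((a * x + b * z) / (a + b) - y) ^ 2 / (2 * (a * b / (a + b))) := by
    field_simp
    ring
  rw [e1, e2]

lemma G_semi {a b : ℝ} (ha : 0 < a) (hb : 0 < b) (x z : ℝ) :
    ∫⁻ y, ENNReal.ofReal (G b x y) * ENNReal.ofReal (G a y z) = ENNReal.ofReal (G (a + b) x z) := by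
  have hab : 0 < a + b := by positivity
  simp_rw [← ENNReal.ofReal_mul (G_pos hb _ _).le, G_mul ha hb,
    ENNReal.ofReal_mul (G_pos hab _ _).le]
  rw [lintegral_const_mul', G_lint (by positivity), mul_one]
  exact ENNReal.ofReal_ne_top

lemma heatP_eq (f : ℝ → ℝ) (t x : ℝ) : heatP f t x = ∫ y, f y * G t x y := rfl

section
variable {f : ℝ → ℝ} (hfm : Measurable f) (hf0 : ∀ x, 0 ≤ f x) (hf1 : (∫ x : ℝ, f x) = 1)
  {t : ℝ} (ht : 0 < t)

lemma f_int (hf1 : (∫ x : ℝ, f x) = 1) : Integrable f := by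
  by_contra h
  rw [integral_undef h] at hf1
  norm_num at hf1

lemma f_lint (hf0 : ∀ x, 0 ≤ f x) (hf1 : (∫ x : ℝ, f x) = 1) :
    ∫⁻ x, ENNReal.ofReal (f x) = 1 := by
  rw [← ofReal_integral_eq_lintegral_ofReal (f_int hf1) (Filter.Eventually.of_forall hf0), hf1]
  simp

lemma fG_int (hf1 : (∫ x : ℝ, f x) = 1) (ht : 0 < t) (x : ℝ) :
    Integrable (fun y => f y * G t x y) := by
  apply (f_int hf1).mul_bdd (c := (Real.sqrt (2 * Real.pi * t))⁻¹)
  · exact ((G_meas t).comp (measurable_const.prodMk measurable_id)).aestronglyMeasurable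
  · refine Filter.Eventually.of_forall fun y => ?_
    rw [Real.norm_of_nonneg (G_pos ht _ _).le]
    exact G_le ht x y

lemma heatP_nonneg (hf0 : ∀ x, 0 ≤ f x) (ht : 0 < t) (x : ℝ) : 0 ≤ heatP f t x := by
  rw [heatP_eq]
  exact integral_nonneg fun y => mul_nonneg (hf0 y) (G_pos ht _ _).le

lemma heatP_pos (hf0 : ∀ x, 0 ≤ f x) (hf1 : (∫ x : ℝ, f x) = 1) (ht : 0 < t) (x : ℝ) :
    0 < heatP f t x := by
  have h1 : 0 < ∫ x, f x := by rw [hf1]; norm_num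
  rw [integral_pos_iff_support_of_nonneg hf0 (f_int hf1)] at h1
  rw [heatP_eq, integral_pos_iff_support_of_nonneg
    (fun y => mul_nonneg (hf0 y) (G_pos ht _ _).le) (fG_int hf1 ht x)]
  convert h1 using 2
  ext y
  simp [(G_pos ht x y).ne']

lemma heatP_le (hf0 : ∀ x, 0 ≤ f x) (hf1 : (∫ x : ℝ, f x) = 1) (ht : 0 < t) (x : ℝ) :
    heatP f t x ≤ (Real.sqrt (2 * Real.pi * t))⁻¹ := by
  rw [heatP_eq]
  calc _ ≤ ∫ y, f y * (Real.sqrt (2 * Real.pi * t))⁻¹ :=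
        integral_mono (fG_int hf1 ht x) ((f_int hf1).mul_const _)
          fun y => mul_le_mul_of_nonneg_left (G_le ht x y) (hf0 y)
    _ = _ := by rw [integral_mul_const, hf1, one_mul]

lemma heatP_meas (hfm : Measurable f) (t : ℝ) : Measurable (heatP f t) := by
  have : StronglyMeasurable (fun x => ∫ y, f y * G t x y) := by
    apply StronglyMeasurable.integral_prod_right (f := fun x y => f y * G t x y)
    exact ((hfm.comp measurable_snd).mul (G_meas t)).stronglyMeasurable
  exact this.measurable

lemma heatP_ofReal (hf0 : ∀ x, 0 ≤ f x) (hf1 : (∫ x : ℝ, f x) = 1) (ht : 0 < t) (x : ℝ) :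
    ENNReal.ofReal (heatP f t x) = ∫⁻ y, ENNReal.ofReal (f y) * ENNReal.ofReal (G t x y) := by
  rw [heatP_eq, ofReal_integral_eq_lintegral_ofReal (fG_int hf1 ht x)
    (Filter.Eventually.of_forall fun y => mul_nonneg (hf0 y) (G_pos ht _ _).le)]
  simp_rw [ENNReal.ofReal_mul (hf0 _)]

lemma Gx_meas (t x : ℝ) : Measurable (fun y => ENNReal.ofReal (G t x y)) := by
  have : Continuous (fun y => G t x y) := by unfold G; fun_prop
  exact this.measurable.ennreal_ofReal

lemma Gy_meas (t y : ℝ) : Measurable (fun x => ENNReal.ofReal (G t x y)) := by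
  have : Continuous (fun x => G t x y) := by unfold G; fun_prop
  exact this.measurable.ennreal_ofReal

/-- Averaging against the kernel preserves the integral. -/
lemma avg_lint (ht : 0 < t) {g : ℝ → ENNReal} (hg : Measurable g) :
    ∫⁻ x, ∫⁻ y, ENNReal.ofReal (G t x y) * g y = ∫⁻ y, g y := by
  rw [lintegral_lintegral_swap]
  · congr 1; ext y
    rw [lintegral_mul_const _ (Gy_meas t y)]
    simp_rw [G_symm t _ y]
    rw [G_lint ht, one_mul]
  · exact ((ENNReal.measurable_ofReal.comp (G_meas t)).mul
      (hg.comp measurable_snd)).aemeasurable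

lemma heatP_lint (hfm : Measurable f) (hf0 : ∀ x, 0 ≤ f x) (hf1 : (∫ x : ℝ, f x) = 1)
    (ht : 0 < t) : ∫⁻ x, ENNReal.ofReal (heatP f t x) = 1 := by
  simp_rw [heatP_ofReal hf0 hf1 ht, mul_comm (ENNReal.ofReal (f _))]
  rw [avg_lint ht hfm.ennreal_ofReal, f_lint hf0 hf1]

lemma heatP_int (hfm : Measurable f) (hf0 : ∀ x, 0 ≤ f x) (hf1 : (∫ x : ℝ, f x) = 1)
    (ht : 0 < t) : Integrable (heatP f t) := by
  refine ⟨(heatP_meas hfm t).aestronglyMeasurable, ?_⟩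
  rw [hasFiniteIntegral_iff_ofReal
    (Filter.Eventually.of_forall (heatP_nonneg hf0 ht)), heatP_lint hfm hf0 hf1 ht]
  simp

lemma heatP_integral (hfm : Measurable f) (hf0 : ∀ x, 0 ≤ f x) (hf1 : (∫ x : ℝ, f x) = 1)
    (ht : 0 < t) : ∫ x, heatP f t x = 1 := by
  rw [integral_eq_lintegral_of_nonneg_ae
    (Filter.Eventually.of_forall (heatP_nonneg hf0 ht))
    (heatP_meas hfm t).aestronglyMeasurable, heatP_lint hfm hf0 hf1 ht]
  simp

lemma heatP_semi (hfm : Measurable f) (hf0 : ∀ x, 0 ≤ f x) (hf1 : (∫ x : ℝ, f x) = 1)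
    {a b : ℝ} (ha : 0 < a) (hb : 0 < b) (x : ℝ) :
    ∫⁻ y, ENNReal.ofReal (G b x y) * ENNReal.ofReal (heatP f a y) =
      ENNReal.ofReal (heatP f (a + b) x) := by
  simp_rw [heatP_ofReal hf0 hf1 ha]
  rw [heatP_ofReal hf0 hf1 (by positivity)]
  simp_rw [← G_semi ha hb]
  have h1 : ∀ y, ENNReal.ofReal (G b x y) *
      (∫⁻ z, ENNReal.ofReal (f z) * ENNReal.ofReal (G a y z)) =
      ∫⁻ z, ENNReal.ofReal (f z) * (ENNReal.ofReal (G b x y) * ENNReal.ofReal (G a y z)) := by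
    intro y
    rw [← lintegral_const_mul' _ _ ENNReal.ofReal_ne_top]
    congr 1; ext z; ring
  simp_rw [h1]
  rw [lintegral_lintegral_swap]
  · congr 1; ext z
    rw [lintegral_const_mul' _ _ ENNReal.ofReal_ne_top]
  · apply Measurable.aemeasurable
    exact (ENNReal.measurable_ofReal.comp (hfm.comp measurable_snd)).mul
      (((Gx_meas b x).comp measurable_fst).mul (ENNReal.measurable_ofReal.comp (G_meas a)))

/-- Gaussian measure centred at `x`. -/
noncomputable def nu (b x : ℝ) : Measure ℝ := volume.withDensity fun y => ENNReal.ofReal (G b x y)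

lemma nu_prob {b : ℝ} (hb : 0 < b) (x : ℝ) : IsProbabilityMeasure (nu b x) := by
  constructor
  rw [nu, withDensity_apply _ MeasurableSet.univ, Measure.restrict_univ, G_lint hb]

lemma nu_lint (b x : ℝ) {g : ℝ → ENNReal} (hg : Measurable g) :
    ∫⁻ y, g y ∂(nu b x) = ∫⁻ y, ENNReal.ofReal (G b x y) * g y := by
  rw [nu, lintegral_withDensity_eq_lintegral_mul _ (Gx_meas b x) hg]
  rfl

lemma nu_heatP (hfm : Measurable f) (hf0 : ∀ x, 0 ≤ f x) (hf1 : (∫ x : ℝ, f x) = 1)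
    {a b : ℝ} (ha : 0 < a) (hb : 0 < b) (x : ℝ) :
    ∫ y, heatP f a y ∂(nu b x) = heatP f (a + b) x := by
  rw [integral_eq_lintegral_of_nonneg_ae
    (Filter.Eventually.of_forall (heatP_nonneg hf0 ha))
    (heatP_meas hfm a).aestronglyMeasurable,
    nu_lint b x (heatP_meas hfm a).ennreal_ofReal,
    heatP_semi hfm hf0 hf1 ha hb, ENNReal.toReal_ofReal (heatP_nonneg hf0 (by positivity) x)]

lemma nu_int_bdd (hfm : Measurable f) (hf0 : ∀ x, 0 ≤ f x) (hf1 : (∫ x : ℝ, f x) = 1)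
    {a b : ℝ} (ha : 0 < a) (hb : 0 < b) (x : ℝ) {Φ : ℝ → ℝ} (hΦm : Measurable Φ)
    (hΦc : ContinuousOn Φ (Set.Ici 0)) : Integrable (fun y => Φ (heatP f a y)) (nu b x) := by
  have := nu_prob hb x
  obtain ⟨C, hC⟩ := (isCompact_Icc (a := (0:ℝ)) (b := (√(2 * π * a))⁻¹)).exists_bound_of_continuousOn
    (hΦc.mono Set.Icc_subset_Ici_self)
  exact Integrable.of_bound (hΦm.comp (heatP_meas hfm a)).aestronglyMeasurable C
    (Filter.Eventually.of_forall fun y =>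
      hC _ ⟨heatP_nonneg hf0 ha y, heatP_le hf0 hf1 ha y⟩)

lemma concave_lint (hfm : Measurable f) (hf0 : ∀ x, 0 ≤ f x) (hf1 : (∫ x : ℝ, f x) = 1)
    {a b : ℝ} (ha : 0 < a) (hb : 0 < b) {Φ : ℝ → ℝ} (hΦm : Measurable Φ)
    (hΦc : ContinuousOn Φ (Set.Ici 0)) (hΦ : ConcaveOn ℝ (Set.Ici 0) Φ)
    (hpos : ∀ x, 0 ≤ Φ (heatP f a x)) :
    ∫⁻ x, ENNReal.ofReal (Φ (heatP f a x)) ≤ ∫⁻ x, ENNReal.ofReal (Φ (heatP f (a + b) x)) := by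
  have hm : Measurable fun y => ENNReal.ofReal (Φ (heatP f a y)) :=
    ENNReal.measurable_ofReal.comp (hΦm.comp (heatP_meas hfm a))
  rw [← avg_lint hb hm]
  refine lintegral_mono fun x => ?_
  have := nu_prob hb x
  have hi := nu_int_bdd hfm hf0 hf1 ha hb x hΦm hΦc
  rw [← nu_lint b x hm, ← ofReal_integral_eq_lintegral_ofReal hi
    (Filter.Eventually.of_forall hpos)]
  apply ENNReal.ofReal_le_ofReal
  rw [← nu_heatP hfm hf0 hf1 ha hb]
  exact hΦ.le_map_integral hΦc isClosed_Ici
    (Filter.Eventually.of_forall fun y => heatP_nonneg hf0 ha y)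
    (nu_int_bdd hfm hf0 hf1 ha hb x measurable_id continuousOn_id) hi

lemma convex_lint (hfm : Measurable f) (hf0 : ∀ x, 0 ≤ f x) (hf1 : (∫ x : ℝ, f x) = 1)
    {a b : ℝ} (ha : 0 < a) (hb : 0 < b) {Φ : ℝ → ℝ} (hΦm : Measurable Φ)
    (hΦc : ContinuousOn Φ (Set.Ici 0)) (hΦ : ConvexOn ℝ (Set.Ici 0) Φ)
    (hpos : ∀ x, 0 ≤ Φ (heatP f a x)) :
    ∫⁻ x, ENNReal.ofReal (Φ (heatP f (a + b) x)) ≤ ∫⁻ x, ENNReal.ofReal (Φ (heatP f a x)) := by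
  have hm : Measurable fun y => ENNReal.ofReal (Φ (heatP f a y)) :=
    ENNReal.measurable_ofReal.comp (hΦm.comp (heatP_meas hfm a))
  rw [← avg_lint hb hm]
  refine lintegral_mono fun x => ?_
  have := nu_prob hb x
  have hi := nu_int_bdd hfm hf0 hf1 ha hb x hΦm hΦc
  rw [← nu_lint b x hm, ← ofReal_integral_eq_lintegral_ofReal hi
    (Filter.Eventually.of_forall hpos)]
  apply ENNReal.ofReal_le_ofReal
  rw [← nu_heatP hfm hf0 hf1 ha hb]
  exact hΦ.map_integral_le hΦc isClosed_Ici
    (Filter.Eventually.of_forall fun y => heatP_nonneg hf0 ha y)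
    (nu_int_bdd hfm hf0 hf1 ha hb x measurable_id continuousOn_id) hi

/-- comparison of integrals from comparison of lower integrals -/
lemma int_of_lint {u v : ℝ → ℝ} (hu : Measurable u) (hu0 : ∀ x, 0 ≤ u x) (hv0 : ∀ x, 0 ≤ v x)
    (hv : Integrable v) (h : ∫⁻ x, ENNReal.ofReal (u x) ≤ ∫⁻ x, ENNReal.ofReal (v x)) :
    Integrable u ∧ ∫ x, u x ≤ ∫ x, v x := by
  have hvf := (hasFiniteIntegral_iff_ofReal (Filter.Eventually.of_forall hv0)).1 hv.2
  have hui : Integrable u := ⟨hu.aestronglyMeasurable,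
    (hasFiniteIntegral_iff_ofReal (Filter.Eventually.of_forall hu0)).2 (h.trans_lt hvf)⟩
  refine ⟨hui, ?_⟩
  rw [← ofReal_integral_eq_lintegral_ofReal hui (Filter.Eventually.of_forall hu0),
    ← ofReal_integral_eq_lintegral_ofReal hv (Filter.Eventually.of_forall hv0)] at h
  exact (ENNReal.ofReal_le_ofReal_iff (integral_nonneg hv0)).1 h

lemma integral_pos' {u : ℝ → ℝ} (hu : ∀ x, 0 < u x) (hi : Integrable u) : 0 < ∫ x, u x := by
  rw [integral_pos_iff_support_of_nonneg (fun x => (hu x).le) hi,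
    show Function.support u = Set.univ from Set.eq_univ_of_forall fun x => (hu x).ne']
  simp

lemma shannon_step (hfm : Measurable f) (hf0 : ∀ x, 0 ≤ f x) (hf1 : (∫ x : ℝ, f x) = 1)
    {a s : ℝ} (ha : 0 < a) (has : a < s)
    (hs : Integrable (fun x => heatP f s x * Real.log (heatP f s x))) :
    Integrable (fun x => heatP f a x * Real.log (heatP f a x)) ∧
    -∫ x, heatP f a x * Real.log (heatP f a x) ≤ -∫ x, heatP f s x * Real.log (heatP f s x) := by
  have hs0 : 0 < s := ha.trans has
  set C := max (√(2 * π * a))⁻¹ (√(2 * π * s))⁻¹ with hC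
  set Φ : ℝ → ℝ := fun u => Real.negMulLog u + Real.log C * u with hΦdef
  have hΦc : Continuous Φ := by
    have := Real.continuous_negMulLog
    fun_prop
  have hΦ : ConcaveOn ℝ (Set.Ici 0) Φ := by
    refine Real.concaveOn_negMulLog.add ?_
    exact ((LinearMap.mul ℝ ℝ) (Real.log C)).concaveOn (convex_Ici 0)
  have hnn : ∀ u, 0 < u → u ≤ C → 0 ≤ Φ u := by
    intro u hu huC
    have := Real.log_le_log hu huC
    simp only [hΦdef, Real.negMulLog]
    nlinarith
  have hpa : ∀ x, 0 ≤ Φ (heatP f a x) := fun x => hnn _ (heatP_pos hf0 hf1 ha x)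
    ((heatP_le hf0 hf1 ha x).trans (le_max_left _ _))
  have hps : ∀ x, 0 ≤ Φ (heatP f s x) := fun x => hnn _ (heatP_pos hf0 hf1 hs0 x)
    ((heatP_le hf0 hf1 hs0 x).trans (le_max_right _ _))
  have key := concave_lint hfm hf0 hf1 ha (sub_pos.2 has) hΦc.measurable hΦc.continuousOn hΦ hpa
  rw [add_sub_cancel] at key
  have eqn : ∀ r, (fun x => Φ (heatP f r x)) =
      fun x => -(heatP f r x * Real.log (heatP f r x)) + Real.log C * heatP f r x := by
    intro r; ext x; simp only [hΦdef, Real.negMulLog]; ring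
  have ipa := heatP_int hfm hf0 hf1 ha
  have ips := heatP_int hfm hf0 hf1 hs0
  have hsi : Integrable (fun x => Φ (heatP f s x)) := by
    rw [eqn]; exact hs.neg.add (ips.const_mul _)
  obtain ⟨h1, h2⟩ := int_of_lint (hΦc.measurable.comp (heatP_meas hfm a)) hpa hps hsi key
  have hai : Integrable (fun x => heatP f a x * Real.log (heatP f a x)) := by
    have h3 : (fun x => heatP f a x * Real.log (heatP f a x)) =
        fun x => Real.log C * heatP f a x - Φ (heatP f a x) := by
      ext x; simp only [hΦdef, Real.negMulLog]; ring
    rw [h3]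
    exact (ipa.const_mul _).sub h1
  refine ⟨hai, ?_⟩
  have val : ∀ r, 0 < r → Integrable (fun x => heatP f r x * Real.log (heatP f r x)) →
      ∫ x, Φ (heatP f r x) = -(∫ x, heatP f r x * Real.log (heatP f r x)) + Real.log C := by
    intro r hr hri
    rw [eqn, integral_add hri.fun_neg ((heatP_int hfm hf0 hf1 hr).const_mul _), integral_neg,
      integral_const_mul, heatP_integral hfm hf0 hf1 hr, mul_one]
  have h2' : ∫ x, Φ (heatP f a x) ≤ ∫ x, Φ (heatP f s x) := h2
  rw [val a ha hai, val s hs0 hs] at h2'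
  linarith

lemma rpow_meas (α : ℝ) : Measurable (fun u : ℝ => u ^ α) := by fun_prop

lemma renyi_lt_step (hfm : Measurable f) (hf0 : ∀ x, 0 ≤ f x) (hf1 : (∫ x : ℝ, f x) = 1)
    {α : ℝ} (hα : 0 < α) (hα1 : α < 1) {a s : ℝ} (ha : 0 < a) (has : a < s)
    (hs : Integrable (fun x => heatP f s x ^ α)) :
    Integrable (fun x => heatP f a x ^ α) ∧
    ∫ x, heatP f a x ^ α ≤ ∫ x, heatP f s x ^ α := by
  have hs0 : 0 < s := ha.trans has
  have hpa : ∀ x, 0 ≤ heatP f a x ^ α := fun x => Real.rpow_nonneg (heatP_nonneg hf0 ha x) _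
  have hps : ∀ x, 0 ≤ heatP f s x ^ α := fun x => Real.rpow_nonneg (heatP_nonneg hf0 hs0 x) _
  have key := concave_lint hfm hf0 hf1 ha (sub_pos.2 has) (rpow_meas α)
    (Real.continuous_rpow_const hα.le).continuousOn (Real.concaveOn_rpow hα.le hα1.le) hpa
  rw [add_sub_cancel] at key
  exact int_of_lint ((rpow_meas α).comp (heatP_meas hfm a)) hpa hps hs key

lemma renyi_gt_int (hfm : Measurable f) (hf0 : ∀ x, 0 ≤ f x) (hf1 : (∫ x : ℝ, f x) = 1)
    {α : ℝ} (hα1 : 1 < α) {a : ℝ} (ha : 0 < a) :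
    Integrable (fun x => heatP f a x ^ α) := by
  have h := (heatP_int hfm hf0 hf1 ha).mul_bdd (c := ((√(2 * π * a))⁻¹) ^ (α - 1))
    (g := fun x => heatP f a x ^ (α - 1))
    ((rpow_meas _).comp (heatP_meas hfm a)).aestronglyMeasurable
    (Filter.Eventually.of_forall fun x => by
      rw [Real.norm_of_nonneg (Real.rpow_nonneg (heatP_nonneg hf0 ha x) _)]
      exact Real.rpow_le_rpow (heatP_nonneg hf0 ha x) (heatP_le hf0 hf1 ha x) (by linarith))
  convert h using 1
  ext x
  simp [← Real.rpow_one_add' (heatP_nonneg hf0 ha x) (show 1 + (α - 1) ≠ 0 by linarith)]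

lemma renyi_gt_step (hfm : Measurable f) (hf0 : ∀ x, 0 ≤ f x) (hf1 : (∫ x : ℝ, f x) = 1)
    {α : ℝ} (hα1 : 1 < α) {a s : ℝ} (ha : 0 < a) (has : a < s) :
    ∫ x, heatP f s x ^ α ≤ ∫ x, heatP f a x ^ α := by
  have hs0 : 0 < s := ha.trans has
  have hpa : ∀ x, 0 ≤ heatP f a x ^ α := fun x => Real.rpow_nonneg (heatP_nonneg hf0 ha x) _
  have hps : ∀ x, 0 ≤ heatP f s x ^ α := fun x => Real.rpow_nonneg (heatP_nonneg hf0 hs0 x) _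
  have key := convex_lint hfm hf0 hf1 ha (sub_pos.2 has) (rpow_meas α)
    (Real.continuous_rpow_const (by linarith)).continuousOn (convexOn_rpow hα1.le) hpa
  rw [add_sub_cancel] at key
  exact (int_of_lint ((rpow_meas α).comp (heatP_meas hfm s)) hps hpa
    (renyi_gt_int hfm hf0 hf1 hα1 ha) key).2

lemma rpow_int_pos (hf0 : ∀ x, 0 ≤ f x) (hf1 : (∫ x : ℝ, f x) = 1) (ht : 0 < t) {α : ℝ}
    (hi : Integrable (fun x => heatP f t x ^ α)) : 0 < ∫ x, heatP f t x ^ α :=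
  integral_pos' (fun x => Real.rpow_pos_of_pos (heatP_pos hf0 hf1 ht x) _) hi

lemma essSup_step (hfm : Measurable f) (hf0 : ∀ x, 0 ≤ f x) (hf1 : (∫ x : ℝ, f x) = 1)
    {a s : ℝ} (ha : 0 < a) (has : a < s) :
    minEnt f a ≤ minEnt f s := by
  have hs0 : 0 < s := ha.trans has
  have hbdd : ∀ r, 0 < r → ∀ᵐ x : ℝ, heatP f r x ≤ essSup (fun x => heatP f r x) volume := by
    intro r hr
    exact ae_le_essSup (Filter.isBoundedUnder_of ⟨_, heatP_le hf0 hf1 hr⟩)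
  have hpos : 0 < essSup (fun x => heatP f s x) volume := by
    obtain ⟨x, hx⟩ := (hbdd s hs0).exists
    exact (heatP_pos hf0 hf1 hs0 x).trans_le hx
  have hle : ∀ x, heatP f s x ≤ essSup (fun x => heatP f a x) volume := by
    intro x
    have hb : 0 < s - a := sub_pos.2 has
    have := nu_prob hb x
    have h1 := nu_heatP hfm hf0 hf1 ha hb x
    rw [add_sub_cancel] at h1
    rw [← h1]
    have h2 : ∀ᵐ y ∂(nu (s - a) x), heatP f a y ≤ essSup (fun x => heatP f a x) volume :=
      (withDensity_absolutelyContinuous _ _).ae_le (hbdd a ha)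
    calc _ ≤ ∫ y, essSup (fun x => heatP f a x) volume ∂(nu (s - a) x) :=
          integral_mono_ae (nu_int_bdd hfm hf0 hf1 ha hb x measurable_id continuousOn_id)
            (integrable_const _) h2
      _ = _ := by simp
  have hmain : essSup (fun x => heatP f s x) volume ≤ essSup (fun x => heatP f a x) volume := by
    refine essSup_le_of_ae_le _ (Filter.Eventually.of_forall hle) ?_
    exact Filter.IsCoboundedUnder.of_frequently_ge (a := 0)
      (Filter.Eventually.frequently
        (Filter.Eventually.of_forall fun x => heatP_nonneg hf0 hs0 x))
  unfold minEnt
  have := Real.log_le_log hpos hmain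
  linarith

lemma deriv_nonneg_of_mono {h : ℝ → ℝ} {u : Set ℝ} (hu : IsOpen u) (hm : MonotoneOn h u)
    (ht : t ∈ u) : 0 ≤ deriv h t := by
  rw [← derivWithin_of_isOpen hu ht]
  exact hm.derivWithin_nonneg

end

end RenyiAux

open RenyiAux in
theorem renyi_first_derivative_nonneg
    (f : ℝ → ℝ) (hfm : Measurable f) (hf0 : ∀ x, 0 ≤ f x)
    (hf1 : (∫ x : ℝ, f x) = 1) :
    (∀ α : ℝ, 0 < α → ∀ t : ℝ, 0 < t → ltTalpha f α t →
      0 ≤ deriv (fun s => renyiEnt f α s) t)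
    ∧ (∀ t : ℝ, 0 < t → 0 ≤ deriv (fun s => minEnt f s) t) := by
  constructor
  · rintro α hα t ht ⟨s, hts, hs0, hs⟩
    refine deriv_nonneg_of_mono (u := Set.Ioo 0 s) isOpen_Ioo ?_ ⟨ht, hts⟩
    rintro a ⟨ha, has⟩ b ⟨hb, hbs⟩ hab
    rcases hab.eq_or_lt with rfl | hab
    · exact le_rfl
    rcases lt_trichotomy α 1 with h1 | h1 | h1
    · simp only [renyiFinite, renyiEnt, if_neg h1.ne] at hs ⊢
      have hbi := renyi_lt_step hfm hf0 hf1 hα h1 hb hbs hs.1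
      have hai := renyi_lt_step hfm hf0 hf1 hα h1 ha hab hbi.1
      exact mul_le_mul_of_nonneg_left
        (Real.log_le_log (rpow_int_pos hf0 hf1 ha hai.1) hai.2)
        (inv_nonneg.2 (by linarith))
    · subst h1
      simp only [renyiFinite, renyiEnt, if_true] at hs ⊢
      have hbi := shannon_step hfm hf0 hf1 hb hbs hs
      exact (shannon_step hfm hf0 hf1 ha hab hbi.1).2
    · simp only [renyiEnt, if_neg h1.ne']
      exact mul_le_mul_of_nonpos_left
        (Real.log_le_log (rpow_int_pos hf0 hf1 hb (renyi_gt_int hfm hf0 hf1 h1 hb))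
          (renyi_gt_step hfm hf0 hf1 h1 ha hab))
        (inv_nonpos.2 (by linarith))
  · intro t ht
    refine deriv_nonneg_of_mono (u := Set.Ioi 0) isOpen_Ioi ?_ ht
    intro a ha b hb hab
    rcases hab.eq_or_lt with rfl | hab
    · exact le_rfl
    · exact essSup_step hfm hf0 hf1 ha hab
end
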